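/- (Commutator p-th power inequality, final Remark of Section 5, unitary case.) Let 0<p<1. For every n, every unitary u ∈ M_n(ℂ) and every positive semidefinite f ∈ M_n(ℂ): ‖u f^{p} − f^{p} u‖_1 ≤ ‖u f − f u‖_p^{p}, where f^{p} is defined by the spectral functional calculus. -/

import Mathlib

open scoped BigOperators
open Matrix MeasureTheory
open scoped ComplexOrder

/-- `A^β` for a Hermitian (in practice positive semidefinite) matrix `A`, via the
spectral functional calculus (with the conventions of `Real.rpow` on eigenvalues,
in particular `0 ^ β = 0` for `β ≠ 0`), extended by `0` to non-Hermitian matrices. -/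
noncomputable def posPow {ι : Type*} [Fintype ι] [DecidableEq ι]
    (A : Matrix ι ι ℂ) (β : ℝ) : Matrix ι ι ℂ :=
  if hA : A.IsHermitian then hA.cfc (fun t => t ^ β) else 0

/-- Schatten `p`-(quasi)norm of a complex matrix: `(Tr((A*A)^(p/2)))^(1/p)`. -/
noncomputable def schattenNorm {ι : Type*} [Fintype ι] [DecidableEq ι]
    (p : ℝ) (A : Matrix ι ι ℂ) : ℝ :=
  ((posPow (Aᴴ * A) (p / 2)).trace.re) ^ (1 / p)

/-- Operator norm of a matrix, acting on the Euclidean space. -/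
noncomputable def opNorm {ι : Type*} [Fintype ι] [DecidableEq ι]
    (A : Matrix ι ι ℂ) : ℝ :=
  ‖Matrix.toEuclideanCLM (𝕜 := ℂ) A‖

/-- The quantity `|||x|||_p` for `0 < p ≤ 2`: the infimum of
`‖(∑ aₖ*aₖ)^(1/2)‖_p + ‖(∑ bₖbₖ*)^(1/2)‖_p` over decompositions `xₖ = aₖ + bₖ`. -/
noncomputable def tripleNorm {n N : ℕ} (p : ℝ)
    (x : Fin N → Matrix (Fin n) (Fin n) ℂ) : ℝ :=
  sInf { r : ℝ | ∃ a b : Fin N → Matrix (Fin n) (Fin n) ℂ,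
    (∀ k, x k = a k + b k) ∧
    r = schattenNorm p (posPow (∑ k, (a k)ᴴ * a k) (1/2))
        + schattenNorm p (posPow (∑ k, b k * (b k)ᴴ) (1/2)) }

/-- `E_ε ‖∑ ε_k x_k‖_p ^ p`, the average over a uniformly random choice of signs. -/
noncomputable def radAvg {n N : ℕ} (p : ℝ)
    (x : Fin N → Matrix (Fin n) (Fin n) ℂ) : ℝ :=
  (1 / 2 ^ N) * ∑ ε : Fin N → Bool,
    (schattenNorm p (∑ k, (if ε k then (1 : ℂ) else -1) • x k)) ^ p

section TraceInequalities

open scoped MatrixOrder Matrix.Norms.L2Operator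

variable {ι : Type*} [Fintype ι]

lemma re_trace_nonneg {A : Matrix ι ι ℂ} (hA : 0 ≤ A) : 0 ≤ A.trace.re :=
  (Complex.le_def.mp (Matrix.nonneg_iff_posSemidef.mp hA).trace_nonneg).1

variable [DecidableEq ι]

lemma continuousOn_real_spectrum (A : Matrix ι ι ℂ) (f : ℝ → ℝ) :
    ContinuousOn f (spectrum ℝ A) :=
  Matrix.finite_real_spectrum.continuousOn f

lemma posPow_eq_cfc {A : Matrix ι ι ℂ} (hA : A.IsHermitian) (β : ℝ) :
    posPow A β = cfc (fun t : ℝ => t ^ β) A := by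
  rw [posPow, dif_pos hA, hA.cfc_eq]

lemma posPow_eq_rpow {A : Matrix ι ι ℂ} (hA : 0 ≤ A) (β : ℝ) : posPow A β = A ^ β := by
  rw [posPow_eq_cfc (Matrix.nonneg_iff_posSemidef.mp hA).isHermitian, CFC.rpow_eq_cfc_real hA]

lemma re_trace_cfc {A : Matrix ι ι ℂ} (hA : A.IsHermitian) (f : ℝ → ℝ) :
    (cfc f A).trace.re = ∑ i, f (hA.eigenvalues i) := by
  rw [hA.cfc_eq, IsHermitian.cfc, Unitary.conjStarAlgAut_apply, Matrix.trace_mul_comm,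
    ← mul_assoc]
  simp [Matrix.trace]

lemma re_trace_mul_nonneg {A B : Matrix ι ι ℂ} (hA : 0 ≤ A) (hB : 0 ≤ B) :
    0 ≤ (A * B).trace.re := by
  have hs : star (CFC.sqrt B) = CFC.sqrt B := (CFC.sqrt_nonneg B).isSelfAdjoint
  rw [← CFC.sqrt_mul_sqrt_self B hB, ← mul_assoc, Matrix.trace_mul_comm, ← mul_assoc]
  refine re_trace_nonneg ?_
  have h := star_left_conjugate_nonneg hA (CFC.sqrt B)
  rwa [hs] at h

lemma re_trace_mul_le_mul_right {A B C : Matrix ι ι ℂ} (hAB : A ≤ B) (hC : 0 ≤ C) :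
    (A * C).trace.re ≤ (B * C).trace.re := by
  have h := re_trace_mul_nonneg (sub_nonneg.mpr hAB) hC
  rw [sub_mul, Matrix.trace_sub, Complex.sub_re] at h
  linarith

/-- Operator antitonicity of `t ↦ t ^ (p - 1)` on strictly positive elements. -/
lemma rpow_sub_one_antitone {A B : Matrix ι ι ℂ} {p : ℝ} (hp0 : 0 < p) (hp1 : p < 1)
    (hA : IsStrictlyPositive A) (hAB : A ≤ B) : B ^ (p - 1) ≤ A ^ (p - 1) := by
  have hB : IsStrictlyPositive B := IsStrictlyPositive.of_le hA hAB
  have key : ∀ {C : Matrix ι ι ℂ}, IsStrictlyPositive C →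
      C ^ (p - 1) = (C ^ (-1 : ℝ)) ^ (1 - p) := fun hC => by
    rw [CFC.rpow_rpow _ _ _ (by norm_num) hC]
    congr 1
    ring
  rw [key hA, key hB]
  exact CFC.rpow_le_rpow ⟨by linarith, by linarith⟩ (CStarAlgebra.rpow_neg_one_le_rpow_neg_one hAB hA)

lemma re_trace_rpow_add_le_of_isStrictlyPositive {X Y : Matrix ι ι ℂ} {p : ℝ} (hp0 : 0 < p)
    (hp1 : p < 1) (hX : IsStrictlyPositive X) (hY : IsStrictlyPositive Y) :
    ((X + Y) ^ p).trace.re ≤ (X ^ p).trace.re + (Y ^ p).trace.re := by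
  have hXC : X ≤ X + Y := le_add_of_nonneg_right hY.nonneg
  have hYC : Y ≤ X + Y := le_add_of_nonneg_left hX.nonneg
  have split : ∀ {C : Matrix ι ι ℂ}, IsStrictlyPositive C → C ^ p = C ^ (p - 1) * C :=
      fun {C} hC => by
    have h := CFC.rpow_add (a := C) (x := p - 1) (y := 1) hC.isUnit
    rwa [CFC.rpow_one C hC.nonneg, sub_add_cancel] at h
  rw [split (IsStrictlyPositive.of_le hX hXC), split hX, split hY, mul_add, Matrix.trace_add,
    Complex.add_re]
  exact add_le_add
    (re_trace_mul_le_mul_right (rpow_sub_one_antitone hp0 hp1 hX hXC) hX.nonneg)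
    (re_trace_mul_le_mul_right (rpow_sub_one_antitone hp0 hp1 hY hYC) hY.nonneg)

lemma re_trace_rpow_add_algebraMap {A : Matrix ι ι ℂ} (hA : 0 ≤ A) {ε p : ℝ} (hε : 0 ≤ ε) :
    ((A + algebraMap ℝ _ ε) ^ p).trace.re =
      ∑ i, ((Matrix.nonneg_iff_posSemidef.mp hA).isHermitian.eigenvalues i + ε) ^ p := by
  have hsa : IsSelfAdjoint A := hA.isSelfAdjoint
  have hAε : A + algebraMap ℝ _ ε = cfc (fun t : ℝ => t + ε) A := by
    rw [cfc_add_const ε (fun t => t) A, cfc_id' ℝ A]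
  rw [CFC.rpow_eq_cfc_real (add_nonneg hA (algebraMap_nonneg _ hε)), hAε,
    ← cfc_comp' (fun t : ℝ => t ^ p) (fun t => t + ε) A
      ((Matrix.finite_real_spectrum (A := A)).image _ |>.continuousOn _), re_trace_cfc]

/-- Rotfeld trace inequality for the power `t ^ p`. -/
lemma re_trace_rpow_add_le {X Y : Matrix ι ι ℂ} {p : ℝ} (hp0 : 0 < p)
    (hp1 : p < 1) (hX : 0 ≤ X) (hY : 0 ≤ Y) :
    ((X + Y) ^ p).trace.re ≤ (X ^ p).trace.re + (Y ^ p).trace.re := by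
  have lim : ∀ {A : Matrix ι ι ℂ}, 0 ≤ A → Filter.Tendsto
      (fun ε : ℝ => ((A + algebraMap ℝ _ ε) ^ p).trace.re) (nhdsWithin 0 (Set.Ioi 0))
      (nhds (A ^ p).trace.re) := fun {A} hA => by
    have hcont : Continuous fun ε : ℝ =>
        ∑ i, ((Matrix.nonneg_iff_posSemidef.mp hA).isHermitian.eigenvalues i + ε) ^ p :=
      continuous_finsetSum _ fun i _ => (continuous_const.add continuous_id).rpow_const
        fun _ => Or.inr hp0.le
    have h0 : (A ^ p).trace.re =
        ∑ i, ((Matrix.nonneg_iff_posSemidef.mp hA).isHermitian.eigenvalues i + 0) ^ p := by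
      rw [← re_trace_rpow_add_algebraMap hA le_rfl, map_zero, add_zero]
    rw [h0]
    refine (hcont.tendsto 0 |>.mono_left nhdsWithin_le_nhds).congr' ?_
    filter_upwards [self_mem_nhdsWithin] with ε hε
    exact (re_trace_rpow_add_algebraMap hA (le_of_lt hε)).symm
  have lim2 : Filter.Tendsto (fun ε : ℝ => ε + ε) (nhdsWithin 0 (Set.Ioi 0))
      (nhdsWithin 0 (Set.Ioi 0)) := by
    refine tendsto_nhdsWithin_iff.mpr ⟨?_, ?_⟩
    · have : Continuous fun ε : ℝ => ε + ε := by fun_prop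
      simpa using (this.tendsto 0).mono_left nhdsWithin_le_nhds
    · filter_upwards [self_mem_nhdsWithin] with ε hε
      exact add_pos (Set.mem_Ioi.mp hε) (Set.mem_Ioi.mp hε)
  refine le_of_tendsto_of_tendsto ((lim (add_nonneg hX hY)).comp lim2) ((lim hX).add (lim hY)) ?_
  filter_upwards [self_mem_nhdsWithin] with ε hε
  have hpos : IsStrictlyPositive (algebraMap ℝ (Matrix ι ι ℂ) ε) :=
    isStrictlyPositive_algebraMap hε
  have h := re_trace_rpow_add_le_of_isStrictlyPositive hp0 hp1 (hpos.nonneg_add hX)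
    (hpos.nonneg_add hY)
  simp only [Function.comp_apply, map_add]
  rwa [add_add_add_comm]

lemma re_trace_cfc_abs_sub_le {M N : Matrix ι ι ℂ} (hM : 0 ≤ M) (hN : 0 ≤ N) :
    (cfc (fun t : ℝ => |t|) (M - N)).trace.re ≤ M.trace.re + N.trace.re := by
  have hsa : IsSelfAdjoint (M - N) := hM.isSelfAdjoint.sub hN.isSelfAdjoint
  set D := M - N with hD
  set S : Matrix ι ι ℂ := cfc (fun t : ℝ => (SignType.sign t : ℝ)) D with hS
  have hDS : cfc (fun t : ℝ => |t|) D = D * S := by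
    conv_rhs => enter [1]; rw [← cfc_id' ℝ D]
    rw [hS]
    rw [← cfc_mul _ _ D (continuousOn_real_spectrum D _) (continuousOn_real_spectrum D _)]
    simp [self_mul_sign]
  have hS1 : 0 ≤ 1 - S := by
    rw [sub_nonneg]
    refine cfc_le_one _ _ fun t _ => ?_
    rcases lt_trichotomy t 0 with h | h | h <;> simp [h]
  have hS2 : 0 ≤ 1 + S := by
    rw [hS, ← cfc_const_one ℝ D, ← cfc_add D _ _ (continuousOn_real_spectrum D _)
      (continuousOn_real_spectrum D _)]
    refine cfc_nonneg fun t _ => ?_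
    rcases lt_trichotomy t 0 with h | h | h <;> simp [h]
  have h1 := re_trace_mul_nonneg hM hS1
  have h2 := re_trace_mul_nonneg hN hS2
  rw [hDS, hD, sub_mul]
  simp only [mul_sub, mul_add, mul_one, Matrix.trace_sub, Matrix.trace_add, Complex.sub_re,
    Complex.add_re] at h1 h2 ⊢
  linarith

/-- Trace-norm form of the Birman–Koplienko–Solomyak inequality for the power `t ^ p`. -/
lemma re_trace_abs_rpow_sub_rpow_le {A B : Matrix ι ι ℂ} {p : ℝ} (hp0 : 0 < p) (hp1 : p < 1)
    (hA : 0 ≤ A) (hB : 0 ≤ B) :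
    (cfc (fun t : ℝ => |t|) (A ^ p - B ^ p)).trace.re ≤
      (cfc (fun t : ℝ => |t| ^ p) (A - B)).trace.re := by
  have hsa : IsSelfAdjoint (A - B) := hA.isSelfAdjoint.sub hB.isSelfAdjoint
  set D := A - B with hD
  set P : Matrix ι ι ℂ := cfc (fun t : ℝ => t⁺) D with hP
  set N : Matrix ι ι ℂ := cfc (fun t : ℝ => t⁻) D with hN
  have hP0 : 0 ≤ P := cfc_nonneg fun t _ => posPart_nonneg t
  have hN0 : 0 ≤ N := cfc_nonneg fun t _ => negPart_nonneg t
  have hPN : P - N = A - B := by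
    rw [hP, hN, ← cfc_sub _ _ D (continuousOn_real_spectrum D _) (continuousOn_real_spectrum D _)]
    simp only [posPart_sub_negPart]
    exact cfc_id' ℝ D
  have hC : B + P = A + N := by
    rw [← sub_eq_zero] at hPN ⊢
    rw [← hPN]
    abel
  have hpow : ∀ (g : ℝ → ℝ), (∀ t, 0 ≤ g t) →
      (cfc g D : Matrix ι ι ℂ) ^ p = cfc (fun t => g t ^ p) D := fun g hg => by
    rw [CFC.rpow_eq_cfc_real (cfc_nonneg fun t _ => hg t),
      ← cfc_comp' (fun t : ℝ => t ^ p) g D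
        ((Matrix.finite_real_spectrum (A := D)).image _ |>.continuousOn _)
        (continuousOn_real_spectrum D _)]
  have habs : (cfc (fun t : ℝ => |t| ^ p) D).trace.re = (P ^ p).trace.re + (N ^ p).trace.re := by
    rw [hP, hN, hpow _ fun t => posPart_nonneg t, hpow _ fun t => negPart_nonneg t,
      ← Complex.add_re, ← Matrix.trace_add,
      ← cfc_add D _ _ (continuousOn_real_spectrum D _) (continuousOn_real_spectrum D _)]
    congr 3
    funext t
    rcases le_total 0 t with h | h
    · simp [abs_of_nonneg h, posPart_of_nonneg h, negPart_of_nonneg h, Real.zero_rpow hp0.ne']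
    · simp [abs_of_nonpos h, posPart_of_nonpos h, negPart_of_nonpos h, Real.zero_rpow hp0.ne']
  have hA1 : A ^ p ≤ (B + P) ^ p :=
    CFC.rpow_le_rpow ⟨hp0.le, hp1.le⟩ (hC ▸ le_add_of_nonneg_right hN0)
  have hB1 : B ^ p ≤ (B + P) ^ p :=
    CFC.rpow_le_rpow ⟨hp0.le, hp1.le⟩ (le_add_of_nonneg_right hP0)
  have h1 := re_trace_cfc_abs_sub_le (sub_nonneg.mpr hB1) (sub_nonneg.mpr hA1)
  have h2 := re_trace_rpow_add_le hp0 hp1 hB hP0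
  have h3 := re_trace_rpow_add_le hp0 hp1 hA hN0
  rw [sub_sub_sub_cancel_left] at h1
  simp only [Matrix.trace_sub, Complex.sub_re] at h1
  rw [← hC] at h3
  rw [habs]
  linarith

lemma posPow_conjTranspose_mul_self {D : Matrix ι ι ℂ} (hD : D.IsHermitian) (q : ℝ) :
    posPow (Dᴴ * D) (q / 2) = cfc (fun t : ℝ => |t| ^ q) D := by
  have hsa : IsSelfAdjoint D := hD
  rw [posPow_eq_cfc (Matrix.isHermitian_conjTranspose_mul_self D), hD.eq]
  have h : D * D = cfc (fun t : ℝ => t ^ 2) D := by rw [cfc_pow_id D 2, sq]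
  rw [h, ← cfc_comp' (fun t : ℝ => t ^ (q / 2)) (fun t => t ^ 2) D
      ((Matrix.finite_real_spectrum (A := D)).image _ |>.continuousOn _)]
  congr 1
  funext t
  rw [← sq_abs, ← Real.rpow_natCast, ← Real.rpow_mul (abs_nonneg t)]
  congr 1
  push_cast
  ring

lemma posPow_conjTranspose_mul_self_commutator {u F : Matrix ι ι ℂ} (hu : u ∈ Matrix.unitaryGroup ι ℂ)
    (hF : F.IsHermitian) (q : ℝ) :
    posPow ((u * F - F * u)ᴴ * (u * F - F * u)) (q / 2) =
      cfc (fun t : ℝ => |t| ^ q) (F - uᴴ * F * u) := by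
  have h1 : uᴴ * u = 1 := Matrix.mem_unitaryGroup_iff'.mp hu
  have h2 : u * uᴴ = 1 := Matrix.mem_unitaryGroup_iff.mp hu
  have hD : (F - uᴴ * F * u).IsHermitian :=
    hF.sub (Matrix.isHermitian_conjTranspose_mul_mul u hF)
  have h : u * F - F * u = u * (F - uᴴ * F * u) := by
    rw [mul_sub, ← mul_assoc, ← mul_assoc, h2, one_mul]
  rw [← posPow_conjTranspose_mul_self hD, h, Matrix.conjTranspose_mul, mul_assoc,
    ← mul_assoc uᴴ, h1, one_mul]

lemma rpow_unitary_conj {u F : Matrix ι ι ℂ} (hu : u ∈ Matrix.unitaryGroup ι ℂ) (hF : 0 ≤ F)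
    (p : ℝ) : (uᴴ * F * u) ^ p = uᴴ * F ^ p * u := by
  have hsa : IsSelfAdjoint F := hF.isSelfAdjoint
  have hconj : 0 ≤ uᴴ * F * u := star_left_conjugate_nonneg hF u
  let φ := Unitary.conjStarAlgAut ℝ (Matrix ι ι ℂ) (star ⟨u, hu⟩)
  have hφ : ∀ X, φ X = uᴴ * X * u := fun X => Unitary.conjStarAlgAut_star_apply _ X
  rw [← hφ, ← hφ, CFC.rpow_eq_cfc_real (hφ F ▸ hconj), CFC.rpow_eq_cfc_real hF]
  refine (StarAlgHomClass.map_cfc φ _ F (continuousOn_real_spectrum F _) ?_ hsa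
    (hφ F ▸ hconj.isSelfAdjoint)).symm
  rw [show ⇑φ = fun X => uᴴ * X * u from funext hφ]
  fun_prop

end TraceInequalities

/-- The commutator `p`-th power inequality (final remark of Section 5), unitary case. -/
theorem statement19 (p : ℝ) (hp0 : 0 < p) (hp1 : p < 1) (n : ℕ)
    (u f : Matrix (Fin n) (Fin n) ℂ) (hu : u ∈ Matrix.unitaryGroup (Fin n) ℂ)
    (hf : f.PosSemidef) :
    schattenNorm 1 (u * posPow f p - posPow f p * u) ≤
      schattenNorm p (u * f - f * u) ^ p := by
  open scoped MatrixOrder Matrix.Norms.L2Operator in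
  have hf0 : 0 ≤ f := Matrix.nonneg_iff_posSemidef.mpr hf
  have hfp : 0 ≤ f ^ p := CFC.rpow_nonneg
  have hconj : 0 ≤ uᴴ * f * u := star_left_conjugate_nonneg hf0 u
  rw [posPow_eq_rpow hf0, schattenNorm, schattenNorm,
    posPow_conjTranspose_mul_self_commutator hu (Matrix.nonneg_iff_posSemidef.mp hfp).isHermitian,
    posPow_conjTranspose_mul_self_commutator hu hf.isHermitian, ← rpow_unitary_conj hu hf0,
    one_div_one, Real.rpow_one, ← Real.rpow_mul, one_div_mul_cancel hp0.ne', Real.rpow_one]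
  · simpa only [Real.rpow_one] using re_trace_abs_rpow_sub_rpow_le hp0 hp1 hf0 hconj
  · exact re_trace_nonneg (cfc_nonneg fun t _ => by positivity)
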